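/- arXiv:0811.1756 — 2 statements merged into one kernel-verified Lean document; each statement's English description precedes it below -/
import Mathlib

section
/- Let k be a field of characteristic 2 and let g = [[a,b],[c,d]] be an invertible 2×2 matrix over k, so det g = ad + bc ≠ 0. Then (det g)·(g·E₁₂·g⁻¹) = ac·I + a²·E₁₂ + c²·E₂₁ and (det g)·(g·E₂₁·g⁻¹) = bd·I + b²·E₁₂ + d²·E₂₁, where E₁₂, E₂₁ are the elementary matrices and I the identity. Consequently, the conjugation action of g on the quotient of the traceless 2×2 matrices by the scalar matrices is given, in the basis formed by the images of E₁₂ and E₂₁, by the matrix (det g)⁻¹·[[a²,b²],[c²,d²]], i.e. by (det g)⁻¹ times the Frobenius twist F(g) of g. -/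
open Matrix

/-- The elementary matrix `E₁₂`. -/
def E12 (k : Type*) [Field k] : Matrix (Fin 2) (Fin 2) k := !![0, 1; 0, 0]

/-- The elementary matrix `E₂₁`. -/
def E21 (k : Type*) [Field k] : Matrix (Fin 2) (Fin 2) k := !![0, 0; 1, 0]

/-- In characteristic two, `[[d,b],[c,a]]` is the adjugate of `g = [[a,b],[c,d]]`, so it
computes conjugation by `g` scaled by `det g`. -/
theorem smul_conj_eq_of_charTwo {k : Type*} [Field k] [CharP k 2] {a b c d : k}
    (h : a * d + b * c ≠ 0) (M : Matrix (Fin 2) (Fin 2) k) :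
    (a * d + b * c) • (!![a, b; c, d] * M * (!![a, b; c, d])⁻¹) =
      !![a, b; c, d] * M * !![d, b; c, a] := by
  have hdet : (!![a, b; c, d] : Matrix (Fin 2) (Fin 2) k).det = a * d + b * c := by
    rw [det_fin_two_of, CharTwo.sub_eq_add]
  rw [inv_def, hdet, Ring.inverse_eq_inv', adjugate_fin_two_of, Matrix.mul_smul, smul_smul,
    mul_inv_cancel₀ h, one_smul, CharTwo.neg_eq, CharTwo.neg_eq]

/-- If `s • X` equals `y • Y + z • Z` up to a scalar matrix and `s ≠ 0`, then `X` equals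
`s⁻¹ • (y • Y + z • Z)` modulo the scalar matrices. -/
theorem mkQ_span_one_eq_inv_smul {k : Type*} [Field k] {X Y Z : Matrix (Fin 2) (Fin 2) k}
    {s t y z : k} (hs : s ≠ 0)
    (hX : s • X = t • (1 : Matrix (Fin 2) (Fin 2) k) + y • Y + z • Z) :
    (Submodule.span k {(1 : Matrix (Fin 2) (Fin 2) k)}).mkQ X =
      s⁻¹ • (y • (Submodule.span k {(1 : Matrix (Fin 2) (Fin 2) k)}).mkQ Y +
        z • (Submodule.span k {(1 : Matrix (Fin 2) (Fin 2) k)}).mkQ Z) := by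
  have h1 : (Submodule.span k {(1 : Matrix (Fin 2) (Fin 2) k)}).mkQ 1 = 0 := by
    simp
  rw [eq_inv_smul_iff₀ hs, ← map_smul, hX, map_add, map_add, map_smul, map_smul, map_smul, h1,
    smul_zero, zero_add]

/-- Let `k` be a field of characteristic two and `g = [[a,b],[c,d]]`
invertible, `det g = ad + bc ≠ 0`. Then
`(det g)·(g E₁₂ g⁻¹) = ac·I + a²·E₁₂ + c²·E₂₁` and
`(det g)·(g E₂₁ g⁻¹) = bd·I + b²·E₁₂ + d²·E₂₁`; consequently, in the quotient modulo
the scalar matrices, conjugation by `g` acts on the images of `E₁₂, E₂₁` by the matrix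
`(det g)⁻¹·[[a²,b²],[c²,d²]]`, i.e. by `(det g)⁻¹` times the Frobenius twist `F(g)`. -/
theorem stmt8 {k : Type*} [Field k] [CharP k 2] (a b c d : k) (h : a * d + b * c ≠ 0) :
    ((a * d + b * c) • (!![a, b; c, d] * E12 k * (!![a, b; c, d])⁻¹) =
      (a * c) • (1 : Matrix (Fin 2) (Fin 2) k) + (a ^ 2) • E12 k + (c ^ 2) • E21 k) ∧
    ((a * d + b * c) • (!![a, b; c, d] * E21 k * (!![a, b; c, d])⁻¹) =
      (b * d) • (1 : Matrix (Fin 2) (Fin 2) k) + (b ^ 2) • E12 k + (d ^ 2) • E21 k) ∧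
    ((Submodule.span k {(1 : Matrix (Fin 2) (Fin 2) k)}).mkQ
        (!![a, b; c, d] * E12 k * (!![a, b; c, d])⁻¹) =
      (a * d + b * c)⁻¹ •
        ((a ^ 2) • (Submodule.span k {(1 : Matrix (Fin 2) (Fin 2) k)}).mkQ (E12 k) +
         (c ^ 2) • (Submodule.span k {(1 : Matrix (Fin 2) (Fin 2) k)}).mkQ (E21 k))) ∧
    ((Submodule.span k {(1 : Matrix (Fin 2) (Fin 2) k)}).mkQ
        (!![a, b; c, d] * E21 k * (!![a, b; c, d])⁻¹) =
      (a * d + b * c)⁻¹ •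
        ((b ^ 2) • (Submodule.span k {(1 : Matrix (Fin 2) (Fin 2) k)}).mkQ (E12 k) +
         (d ^ 2) • (Submodule.span k {(1 : Matrix (Fin 2) (Fin 2) k)}).mkQ (E21 k))) := by
  have h12 : (a * d + b * c) • (!![a, b; c, d] * E12 k * (!![a, b; c, d])⁻¹) =
      (a * c) • (1 : Matrix (Fin 2) (Fin 2) k) + (a ^ 2) • E12 k + (c ^ 2) • E21 k := by
    rw [smul_conj_eq_of_charTwo h]
    ext i j
    fin_cases i <;> fin_cases j <;> simp [E12, E21] <;> ring
  have h21 : (a * d + b * c) • (!![a, b; c, d] * E21 k * (!![a, b; c, d])⁻¹) =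
      (b * d) • (1 : Matrix (Fin 2) (Fin 2) k) + (b ^ 2) • E12 k + (d ^ 2) • E21 k := by
    rw [smul_conj_eq_of_charTwo h]
    ext i j
    fin_cases i <;> fin_cases j <;> simp [E12, E21] <;> ring
  exact ⟨h12, h21, mkQ_span_one_eq_inv_smul h h12, mkQ_span_one_eq_inv_smul h h21⟩
end

section
/- Let k be a field of characteristic 2, let W and A be k-vector spaces, let Q_A be a quadratic form on A with polar form β (β(y,y') = Q_A(y+y') + Q_A(y) + Q_A(y')), and let φ : W → A and ψ : A → W* be linear maps satisfying β(φ(x), y) = ⟨x, ψ(y)⟩ for all x ∈ W, y ∈ A, where ⟨·,·⟩ is the canonical pairing between W and its dual W*. Define the quadratic form Q on E = W ⊕ A ⊕ W* by Q(x + y + x*) = ⟨x, x*⟩ + Q_A(y), and for s ∈ k define the linear map g_s : E → E by g_s(x, y, x*) = (x, y + s·φ(x), x* + s·ψ(y)). Then Q(g_s(x, y, x*)) = Q(x, y, x*) + s²·Q_A(φ(x)) for all x ∈ W, y ∈ A, x* ∈ W*. -/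
/-- Let `k` be a field of characteristic two, `Q_A` a quadratic form on
`A` with polar form `β`, and `φ : W → A`, `ψ : A → W*` linear maps satisfying
`β(φ x, y) = ⟨x, ψ y⟩`. Define `Q` on `E = W ⊕ A ⊕ W*` by
`Q(x + y + x*) = ⟨x, x*⟩ + Q_A(y)` and `g_s (x, y, x*) = (x, y + s·φ x, x* + s·ψ y)`.
Then `Q (g_s (x, y, x*)) = Q (x, y, x*) + s²·Q_A(φ x)`. -/
theorem stmt9 (k W A : Type*) [Field k] [CharP k 2]
    [AddCommGroup W] [Module k W] [AddCommGroup A] [Module k A]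
    (QA : QuadraticForm k A) (β : A → A → k)
    (hβ : ∀ y y' : A, β y y' = QA (y + y') + QA y + QA y')
    (φ : W →ₗ[k] A) (ψ : A →ₗ[k] Module.Dual k W)
    (hc : ∀ (x : W) (y : A), β (φ x) y = ψ y x)
    (s : k)
    (Q : W × A × Module.Dual k W → k)
    (hQ : ∀ (x : W) (y : A) (x' : Module.Dual k W), Q (x, y, x') = x' x + QA y)
    (gs : W × A × Module.Dual k W → W × A × Module.Dual k W)
    (hgs : ∀ (x : W) (y : A) (x' : Module.Dual k W),
      gs (x, y, x') = (x, y + s • φ x, x' + s • ψ y)) :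
    ∀ (x : W) (y : A) (x' : Module.Dual k W),
      Q (gs (x, y, x')) = Q (x, y, x') + s ^ 2 * QA (φ x) := by
  intro x y x'
  have hpolar : QuadraticMap.polar QA (φ x) y = ψ y x := by
    rw [← hc, hβ, QuadraticMap.polar, CharTwo.sub_eq_add, CharTwo.sub_eq_add]
  have hadd : QA (y + s • φ x) = s * s * QA (φ x) + QA y + s * ψ y x := by
    rw [add_comm, QuadraticMap.map_add QA, QuadraticMap.map_smul,
      QuadraticMap.polar_smul_left, hpolar, smul_eq_mul, smul_eq_mul]
  rw [hgs, hQ, hQ, hadd, LinearMap.add_apply, LinearMap.smul_apply, smul_eq_mul]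
  linear_combination CharTwo.add_self_eq_zero (s * ψ y x)
end
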